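/- 𝒦*(H) with 𝒦ⁿ(H) = H^⊗(n+1), the stated product, and the differential d(h⁰⊗⋯⊗hⁿ) = −(1⊗h⁰⊗⋯⊗hⁿ) + Σⱼ₌₀ⁿ⁻¹ (−1)ʲ (h⁰⊗⋯⊗hʲ₍₁₎⊗hʲ₍₂₎⊗⋯⊗hⁿ) + (−1)ⁿ (h⁰⊗⋯⊗hⁿ⁻¹ ⊗ hⁿ₍₁₎S⁻¹(hⁿ₍₃₎) ⊗ hⁿ₍₂₎) is a differential graded k-algebra: d is a graded derivation (d(ΨΦ) = d(Ψ)Φ + (−1)^{|Ψ|}Ψd(Φ)) and d² = 0. -/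

import Mathlib

/- STATEMENT 10: 𝒦*(H) with 𝒦ⁿ(H) = H^⊗(n+1), the stated product, and the differential
d(h⁰⊗⋯⊗hⁿ) = −(1⊗h⁰⊗⋯⊗hⁿ) + Σⱼ(−1)ʲ(h⁰⊗⋯⊗hʲ₍₁₎⊗hʲ₍₂₎⊗⋯⊗hⁿ)
+ (−1)ⁿ(h⁰⊗⋯⊗hⁿ₍₁₎S⁻¹(hⁿ₍₃₎)⊗hⁿ₍₂₎) is a differential graded k-algebra: the product is
associative, d is a graded derivation, and d² = 0. -/

open TensorProduct

noncomputable section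

variable (k : Type) [Field k] (H : Type) [Ring H] [HopfAlgebra k H]

def Delta2 : H →ₗ[k] (H ⊗[k] H) ⊗[k] H :=
  (TensorProduct.map Coalgebra.comul LinearMap.id) ∘ₗ Coalgebra.comul

variable {A B C : Type} [AddCommGroup A] [AddCommGroup B] [AddCommGroup C]
  [Module k A] [Module k B] [Module k C]

def sw3 : (A ⊗[k] B) ⊗[k] C →ₗ[k] (A ⊗[k] C) ⊗[k] B :=
  (TensorProduct.assoc k A C B).symm.toLinearMap
    ∘ₗ (TensorProduct.map LinearMap.id (TensorProduct.comm k B C).toLinearMap)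
    ∘ₗ (TensorProduct.assoc k A B C).toLinearMap

def twist (X : Type) [AddCommGroup X] [Module k X] (Sm : H →ₗ[k] H)
    (act : H ⊗[k] X →ₗ[k] X) : H ⊗[k] (H ⊗[k] X) →ₗ[k] H ⊗[k] X :=
  (TensorProduct.map (LinearMap.mul' k H) act)
    ∘ₗ (TensorProduct.tensorTensorTensorComm k H H H X).toLinearMap
    ∘ₗ (TensorProduct.map
          ((TensorProduct.map (LinearMap.mul' k H) LinearMap.id) ∘ₗ sw3 k)
          (TensorProduct.map Sm LinearMap.id))
    ∘ₗ (TensorProduct.tensorTensorTensorComm k (H ⊗[k] H) H H X).toLinearMap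
    ∘ₗ (TensorProduct.map (Delta2 k H) LinearMap.id)

variable (Sinv : H →ₗ[k] H)

/-- `𝒦ⁿ(H) = H^⊗(n+1)`, nested as `H ⊗ (H ⊗ (⋯ ⊗ H))`. -/
def KC : ℕ → ModuleCat k := fun n =>
  Nat.rec (ModuleCat.of k H) (fun _ ih => ModuleCat.of k (H ⊗[k] ih)) n

/-- The left action of `H` on `𝒦ⁿ(H)` : `h·(h⁰⊗⋯⊗hⁿ) = h₍₁₎h⁰S⁻¹(h₍₂ₙ₊₁₎)⊗⋯⊗h₍ₙ₊₁₎hⁿ`. -/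
def lactK : ∀ n : ℕ, H ⊗[k] (KC k H n) →ₗ[k] (KC k H n)
  | 0 => LinearMap.mul' k H
  | n + 1 => twist k H (KC k H n) Sinv (lactK n)

/-- The product `𝒦ⁿ(H) ⊗ 𝒦ᵐ(H) → 𝒦ⁿ⁺ᵐ(H)`. -/
def muK : ∀ (n m : ℕ), (KC k H n) ⊗[k] (KC k H m) →ₗ[k] KC k H (m + n)
  | 0, m => lactK k H Sinv m
  | n + 1, m =>
    (TensorProduct.map LinearMap.id (muK n m))
      ∘ₗ (TensorProduct.assoc k H (KC k H n) (KC k H m)).toLinearMap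

/-- `(h₁ ⊗ h₂) ⊗ h₃ ↦ h₁ Sinv(h₃) ⊗ h₂`. -/
def phi2 : (H ⊗[k] H) ⊗[k] H →ₗ[k] H ⊗[k] H :=
  (TensorProduct.map (LinearMap.mul' k H) LinearMap.id)
    ∘ₗ (TensorProduct.map (TensorProduct.map LinearMap.id Sinv) LinearMap.id)
    ∘ₗ sw3 k

/-- The identification `𝒦ⁿ⁺¹(H) = H ⊗ 𝒦ⁿ(H)`. -/
def unroll (n : ℕ) : (KC k H (n + 1)) →ₗ[k] H ⊗[k] (KC k H n) := LinearMap.id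

/-- The differential of `𝒦*(H)`. -/
def dK : ∀ n : ℕ, (KC k H n) →ₗ[k] (KC k H (n + 1))
  | 0 => (phi2 k H Sinv ∘ₗ Delta2 k H) - (TensorProduct.mk k H H 1)
  | n + 1 =>
    ((TensorProduct.assoc k H H (KC k H n)).toLinearMap
        ∘ₗ (TensorProduct.map Coalgebra.comul LinearMap.id))
      - (TensorProduct.mk k H (H ⊗[k] (KC k H n)) 1)
      - (TensorProduct.map (LinearMap.id : H →ₗ[k] H) (TensorProduct.mk k H (KC k H n) 1))
      - (TensorProduct.map (LinearMap.id : H →ₗ[k] H) (unroll k H n ∘ₗ dK n))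

/-- Transport along an equality of degrees. -/
def dcast {a b : ℕ} (h : a = b) : (KC k H a) →ₗ[k] (KC k H b) := by
  subst h; exact LinearMap.id

/-- The map `x ⊗ y ↦ x₍₁₎ ⊗ (x₍₂₎ ⊗ y)`. -/
def comulAssoc (X : Type) [AddCommGroup X] [Module k X] : H ⊗[k] X →ₗ[k] H ⊗[k] (H ⊗[k] X) :=
  (TensorProduct.assoc k H H X).toLinearMap ∘ₗ (TensorProduct.map Coalgebra.comul LinearMap.id)

/-- Left multiplication on the first tensor factor. -/
def leftMulEnd (X : Type) [AddCommGroup X] [Module k X] : H →ₗ[k] Module.End k (H ⊗[k] X) :=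
  LinearMap.rTensorHom X ∘ₗ LinearMap.mul k H

/-- Right multiplication by `Sinv h` on the first tensor factor. -/
def rightMulEnd (X : Type) [AddCommGroup X] [Module k X] : H →ₗ[k] Module.End k (H ⊗[k] X) :=
  LinearMap.rTensorHom X ∘ₗ (LinearMap.mul k H).flip ∘ₗ Sinv

/-- The action on the second tensor factor. -/
def actEnd {X : Type} [AddCommGroup X] [Module k X] (ρ : H →ₗ[k] Module.End k X) :
    H →ₗ[k] Module.End k (H ⊗[k] X) :=
  LinearMap.lTensorHom H ∘ₗ ρ

section Twist

open WithConv

variable {k H Sinv}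
variable {X Y : Type} [AddCommGroup X] [Module k X] [AddCommGroup Y] [Module k Y]

@[simp]
theorem comulAssoc_tmul (x : H) (y : X) :
    comulAssoc k H X (x ⊗ₜ y) =
      TensorProduct.assoc k H H X (Coalgebra.comul (R := k) x ⊗ₜ y) := rfl

@[simp]
theorem leftMulEnd_tmul (h x : H) (y : X) :
    leftMulEnd k H X h (x ⊗ₜ y) = (h * x) ⊗ₜ y := rfl

@[simp]
theorem rightMulEnd_tmul (h x : H) (y : X) :
    rightMulEnd k H Sinv X h (x ⊗ₜ y) = (x * Sinv h) ⊗ₜ y := rfl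

@[simp]
theorem actEnd_tmul (ρ : H →ₗ[k] Module.End k X) (h x : H) (y : X) :
    actEnd k H ρ h (x ⊗ₜ y) = x ⊗ₜ ρ h y := rfl

theorem curry_twist (act : H ⊗[k] X →ₗ[k] X) :
    toConv (TensorProduct.curry (twist k H X Sinv act)) =
      toConv (leftMulEnd k H X) * toConv (actEnd k H (TensorProduct.curry act)) *
        toConv (rightMulEnd k H Sinv X) := by
  apply WithConv.ofConv_injective
  ext h x y
  simp only [twist, Delta2, LinearMap.convMul_def, ofConv_toConv, LinearMap.comp_apply,
    TensorProduct.AlgebraTensorModule.curry_apply, TensorProduct.curry_apply,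
    LinearMap.restrictScalars_self, TensorProduct.map_tmul, LinearMap.id_apply]
  induction Coalgebra.comul (R := k) h with
  | zero => simp
  | add s t hs ht => simp only [map_add, add_tmul, LinearMap.add_apply, hs, ht]
  | tmul a c =>
    simp only [TensorProduct.map_tmul, LinearMap.comp_apply, LinearMap.id_apply]
    induction Coalgebra.comul (R := k) a with
    | zero => simp
    | add s t hs ht => simp only [map_add, add_tmul, LinearMap.add_apply, hs, ht]
    | tmul a b => simp [sw3, mul_assoc]

theorem twist_mul (hS : ∀ a b, Sinv (a * b) = Sinv b * Sinv a) (act : H ⊗[k] X →ₗ[k] X)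
    (hact : ∀ g h x, act ((g * h) ⊗ₜ x) = act (g ⊗ₜ act (h ⊗ₜ x))) (g h : H) (z : H ⊗[k] X) :
    twist k H X Sinv act ((g * h) ⊗ₜ z) =
      twist k H X Sinv act (g ⊗ₜ twist k H X Sinv act (h ⊗ₜ z)) := by
  have hD : Delta2 k H (g * h) = Delta2 k H g * Delta2 k H h :=
    map_mul ((Algebra.TensorProduct.map (Bialgebra.comulAlgHom k H) (AlgHom.id k H)).comp
      (Bialgebra.comulAlgHom k H)) g h
  simp only [twist, LinearMap.comp_apply, TensorProduct.map_tmul, LinearMap.id_apply, hD]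
  induction z with
  | zero => simp
  | add s t hs ht => simp only [map_add, tmul_add, hs, ht]
  | tmul x y =>
    induction Delta2 k H g with
    | zero => simp
    | add s t hs ht => simp only [map_add, add_tmul, add_mul, hs, ht]
    | tmul s c =>
      induction s with
      | zero => simp
      | add s t hs ht => simp only [map_add, add_tmul, add_mul, hs, ht]
      | tmul a b =>
        induction Delta2 k H h with
        | zero => simp
        | add s t hs ht => simp only [map_add, add_tmul, tmul_add, mul_add, hs, ht]
        | tmul s c' =>
          induction s with
          | zero => simp
          | add s t hs ht => simp only [map_add, add_tmul, tmul_add, mul_add, hs, ht]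
          | tmul a' b' => simp [sw3, mul_assoc, hact, hS]

/-- A map intertwining two pairs of families of operators intertwines their convolutions. -/
theorem convMul_intertwine {j : X →ₗ[k] Y} {f g : H →ₗ[k] Module.End k X}
    {f' g' : H →ₗ[k] Module.End k Y} (hf : ∀ h x, j (f h x) = f' h (j x))
    (hg : ∀ h x, j (g h x) = g' h (j x)) (h : H) (x : X) :
    j ((toConv f * toConv g).ofConv h x) = (toConv f' * toConv g').ofConv h (j x) := by
  simp only [LinearMap.convMul_def, ofConv_toConv, LinearMap.comp_apply]
  induction Coalgebra.comul (R := k) h with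
  | zero => simp
  | add s t hs ht => simp only [map_add, LinearMap.add_apply, hs, ht]
  | tmul a b => simp [hf, hg]

theorem twist_eq (act : H ⊗[k] X →ₗ[k] X) (h : H) (z : H ⊗[k] X) :
    twist k H X Sinv act (h ⊗ₜ z) =
      (toConv (leftMulEnd k H X) * toConv (actEnd k H (TensorProduct.curry act)) *
        toConv (rightMulEnd k H Sinv X)).ofConv h z := by
  rw [← curry_twist]
  rfl

theorem twist_lTensor {actX : H ⊗[k] X →ₗ[k] X} {actY : H ⊗[k] Y →ₗ[k] Y} {f : X →ₗ[k] Y}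
    (hf : ∀ h x, f (actX (h ⊗ₜ x)) = actY (h ⊗ₜ f x)) (h : H) (z : H ⊗[k] X) :
    f.lTensor H (twist k H X Sinv actX (h ⊗ₜ z)) =
      twist k H Y Sinv actY (h ⊗ₜ f.lTensor H z) := by
  rw [twist_eq, twist_eq]
  refine convMul_intertwine (convMul_intertwine ?_ ?_) ?_ h z <;>
  · intro h z
    induction z with
    | zero => simp
    | add s t hs ht => simp only [map_add, hs, ht]
    | tmul x y => simp [hf]

theorem twist_comulAssoc
    (hS : ∀ a : H, Coalgebra.comul (R := k) (Sinv a) =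
      TensorProduct.map Sinv Sinv (TensorProduct.comm k H H (Coalgebra.comul (R := k) a)))
    (act : H ⊗[k] X →ₗ[k] X) (h : H) (z : H ⊗[k] X) :
    comulAssoc k H X (twist k H X Sinv act (h ⊗ₜ z)) =
      twist k H (H ⊗[k] X) Sinv (twist k H X Sinv act) (h ⊗ₜ comulAssoc k H X z) := by
  have hA : toConv (actEnd k H (TensorProduct.curry (twist k H X Sinv act))) =
      toConv (actEnd k H (leftMulEnd k H X)) *
        toConv (actEnd k H (actEnd k H (TensorProduct.curry act))) *
          toConv (actEnd k H (rightMulEnd k H Sinv X)) := by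
    have hlift (F G : WithConv (H →ₗ[k] Module.End k (H ⊗[k] X))) :
        toConv (actEnd k H (F * G).ofConv) =
          toConv (actEnd k H F.ofConv) * toConv (actEnd k H G.ofConv) := by
      apply WithConv.ofConv_injective
      refine LinearMap.ext fun h => TensorProduct.ext' fun x y => ?_
      simp only [LinearMap.convMul_def, ofConv_toConv, LinearMap.comp_apply, actEnd_tmul]
      induction Coalgebra.comul (R := k) h with
      | zero => simp
      | add s t hs ht => simp only [map_add, LinearMap.add_apply, tmul_add, hs, ht]
      | tmul a b => simp
    have h := congrArg (fun F => toConv (actEnd k H F.ofConv)) (curry_twist (Sinv := Sinv) act)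
    simpa only [hlift, ofConv_toConv] using h
  have hassoc : toConv (leftMulEnd k H (H ⊗[k] X)) *
      toConv (actEnd k H (TensorProduct.curry (twist k H X Sinv act))) *
        toConv (rightMulEnd k H Sinv (H ⊗[k] X)) =
      toConv (toConv (leftMulEnd k H (H ⊗[k] X)) * toConv (actEnd k H (leftMulEnd k H X))).ofConv *
        toConv (actEnd k H (actEnd k H (TensorProduct.curry act))) *
        toConv (toConv (actEnd k H (rightMulEnd k H Sinv X)) *
          toConv (rightMulEnd k H Sinv (H ⊗[k] X))).ofConv := by
    simp only [hA, toConv_ofConv, mul_assoc]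
  rw [twist_eq, twist_eq, hassoc]
  refine convMul_intertwine (convMul_intertwine ?_ ?_) ?_ h z
  · intro h z
    induction z with
    | zero => simp
    | add s t hs ht => simp only [map_add, hs, ht]
    | tmul x y =>
      simp only [leftMulEnd_tmul, comulAssoc_tmul, Bialgebra.comul_mul, LinearMap.convMul_def,
        ofConv_toConv, LinearMap.comp_apply]
      induction Coalgebra.comul (R := k) h with
      | zero => simp
      | add s t hs ht => simp only [map_add, LinearMap.add_apply, add_mul, add_tmul, hs, ht]
      | tmul a b =>
        induction Coalgebra.comul (R := k) x with
        | zero => simp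
        | add s t hs ht => simp only [map_add, mul_add, add_tmul, hs, ht]
        | tmul p q => simp
  · intro h z
    induction z with
    | zero => simp
    | add s t hs ht => simp only [map_add, hs, ht]
    | tmul x y =>
      simp only [actEnd_tmul, comulAssoc_tmul]
      induction Coalgebra.comul (R := k) x with
      | zero => simp
      | add s t hs ht => simp only [map_add, add_tmul, hs, ht]
      | tmul p q => simp
  · intro h z
    induction z with
    | zero => simp
    | add s t hs ht => simp only [map_add, hs, ht]
    | tmul x y =>
      simp only [rightMulEnd_tmul, comulAssoc_tmul, Bialgebra.comul_mul, hS,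
        LinearMap.convMul_def, ofConv_toConv, LinearMap.comp_apply]
      induction Coalgebra.comul (R := k) h with
      | zero => simp
      | add s t hs ht => simp only [map_add, LinearMap.add_apply, mul_add, add_tmul, hs, ht]
      | tmul a b =>
        induction Coalgebra.comul (R := k) x with
        | zero => simp
        | add s t hs ht => simp only [map_add, add_mul, add_tmul, hs, ht]
        | tmul p q => simp

theorem twist_one_tmul (act : H ⊗[k] X →ₗ[k] X) (h : H) (x : X) :
    twist k H X Sinv act (h ⊗ₜ (1 ⊗ₜ x)) =
      (act ∘ₗ (TensorProduct.mk k H X).flip x).lTensor H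
        ((phi2 k H Sinv ∘ₗ Delta2 k H) h) := by
  simp only [twist, LinearMap.comp_apply, TensorProduct.map_tmul, LinearMap.id_apply]
  induction Delta2 k H h with
  | zero => simp
  | add s t hs ht => simp only [map_add, add_tmul, hs, ht]
  | tmul s c =>
    induction s with
    | zero => simp
    | add s t hs ht => simp only [map_add, add_tmul, hs, ht]
    | tmul a b => simp [sw3, phi2]

/-- Extension of `f` to `H ⊗ X` by the recursion defining the differential. -/
def extendD (k H : Type) [Field k] [Ring H] [HopfAlgebra k H] {X : Type} [AddCommGroup X]
    [Module k X] (f : X →ₗ[k] H ⊗[k] X) : H ⊗[k] X →ₗ[k] H ⊗[k] (H ⊗[k] X) :=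
  comulAssoc k H X - f.lTensor H

theorem lTensor_comulAssoc_comulAssoc (z : H ⊗[k] X) :
    (comulAssoc k H X).lTensor H (comulAssoc k H X z) =
      comulAssoc k H (H ⊗[k] X) (comulAssoc k H X z) := by
  induction z with
  | zero => simp
  | add s t hs ht => simp only [map_add, hs, ht]
  | tmul x y =>
    have hL (t : H ⊗[k] H) : (comulAssoc k H X).lTensor H (TensorProduct.assoc k H H X (t ⊗ₜ y)) =
        ((TensorProduct.assoc k H H X).toLinearMap ∘ₗ (TensorProduct.mk k _ X).flip y).lTensor H
          (Coalgebra.comul.lTensor H t) := by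
      induction t with
      | zero => simp
      | add s t hs ht => simp only [map_add, add_tmul, hs, ht]
      | tmul a b => simp
    have hR (t : H ⊗[k] H) : comulAssoc k H (H ⊗[k] X) (TensorProduct.assoc k H H X (t ⊗ₜ y)) =
        ((TensorProduct.assoc k H H X).toLinearMap ∘ₗ (TensorProduct.mk k _ X).flip y).lTensor H
          (TensorProduct.assoc k H H H (Coalgebra.comul.rTensor H t)) := by
      induction t with
      | zero => simp
      | add s t hs ht => simp only [map_add, add_tmul, hs, ht]
      | tmul a b =>
        simp only [TensorProduct.assoc_tmul, comulAssoc_tmul, LinearMap.rTensor_tmul]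
        induction Coalgebra.comul (R := k) a with
        | zero => simp
        | add s t hs ht => simp only [map_add, add_tmul, hs, ht]
        | tmul p q => simp
    rw [comulAssoc_tmul, hL, hR, Coalgebra.coassoc_apply]

theorem comulAssoc_lTensor (f : X →ₗ[k] Y) (z : H ⊗[k] X) :
    comulAssoc k H Y (f.lTensor H z) = (f.lTensor H).lTensor H (comulAssoc k H X z) := by
  induction z with
  | zero => simp
  | add s t hs ht => simp only [map_add, hs, ht]
  | tmul x y =>
    simp only [LinearMap.lTensor_tmul, comulAssoc_tmul]
    induction Coalgebra.comul (R := k) x with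
    | zero => simp
    | add s t hs ht => simp only [map_add, add_tmul, hs, ht]
    | tmul p q => simp

theorem extendD_extendD {f : X →ₗ[k] H ⊗[k] X} (hf : extendD k H f ∘ₗ f = 0) :
    extendD k H (extendD k H f) ∘ₗ extendD k H f = 0 := by
  have hf' (z : H ⊗[k] X) : (extendD k H f).lTensor H (f.lTensor H z) = 0 := by
    rw [← LinearMap.comp_apply, ← LinearMap.lTensor_comp, hf]
    simp
  have hE (z : H ⊗[k] (H ⊗[k] X)) : (extendD k H f).lTensor H z =
      (comulAssoc k H X).lTensor H z - (f.lTensor H).lTensor H z := by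
    rw [extendD, LinearMap.lTensor_sub, LinearMap.sub_apply]
  ext1
  ext x y
  change extendD k H (extendD k H f) (extendD k H f (x ⊗ₜ y)) = 0
  have h1 : extendD k H (extendD k H f) (extendD k H f (x ⊗ₜ y)) =
      comulAssoc k H _ (comulAssoc k H X (x ⊗ₜ y)) - comulAssoc k H _ (f.lTensor H (x ⊗ₜ y)) -
        ((extendD k H f).lTensor H (comulAssoc k H X (x ⊗ₜ y)) -
          (extendD k H f).lTensor H (f.lTensor H (x ⊗ₜ y))) := by
    rw [extendD, LinearMap.sub_apply, extendD, LinearMap.sub_apply, map_sub, map_sub]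
  rw [h1, hf', hE, comulAssoc_lTensor, lTensor_comulAssoc_comulAssoc]
  abel

theorem extendD_one_tmul (f : X →ₗ[k] H ⊗[k] X) (x : X) :
    extendD k H f (1 ⊗ₜ x) = 1 ⊗ₜ (1 ⊗ₜ x) - 1 ⊗ₜ f x := by
  rw [extendD, LinearMap.sub_apply, comulAssoc_tmul, Bialgebra.comul_one,
    Algebra.TensorProduct.one_def, TensorProduct.assoc_tmul, LinearMap.lTensor_tmul]

theorem extendD_twist
    (hS : ∀ a : H, Coalgebra.comul (R := k) (Sinv a) =
      TensorProduct.map Sinv Sinv (TensorProduct.comm k H H (Coalgebra.comul (R := k) a)))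
    {act : H ⊗[k] X →ₗ[k] X} {f : X →ₗ[k] H ⊗[k] X}
    (hf : ∀ h x, f (act (h ⊗ₜ x)) = twist k H X Sinv act (h ⊗ₜ f x)) (h : H) (z : H ⊗[k] X) :
    extendD k H f (twist k H X Sinv act (h ⊗ₜ z)) =
      twist k H (H ⊗[k] X) Sinv (twist k H X Sinv act) (h ⊗ₜ extendD k H f z) := by
  rw [extendD, LinearMap.sub_apply, twist_comulAssoc hS, twist_lTensor hf, LinearMap.sub_apply,
    tmul_sub, map_sub]

theorem extendD_comp_lTensor {f : X →ₗ[k] H ⊗[k] X} {g : Y →ₗ[k] H ⊗[k] Y} {μ : X →ₗ[k] Y}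
    {ν : X →ₗ[k] H ⊗[k] Y} {c : k} (h : g ∘ₗ μ = μ.lTensor H ∘ₗ f + c • ν) :
    extendD k H g ∘ₗ μ.lTensor H =
      (μ.lTensor H).lTensor H ∘ₗ extendD k H f + (-1 * c) • ν.lTensor H := by
  have h' : g.lTensor H ∘ₗ μ.lTensor H =
      (μ.lTensor H).lTensor H ∘ₗ f.lTensor H + c • ν.lTensor H := by
    rw [← LinearMap.lTensor_comp, h, LinearMap.lTensor_add, LinearMap.lTensor_comp,
      LinearMap.lTensor_smul]
  have hc : comulAssoc k H Y ∘ₗ μ.lTensor H =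
      (μ.lTensor H).lTensor H ∘ₗ comulAssoc k H X :=
    LinearMap.ext (comulAssoc_lTensor μ)
  have hn : -c • ν.lTensor H = -(c • ν.lTensor H) := neg_smul c (ν.lTensor H)
  rw [extendD, extendD, LinearMap.sub_comp, LinearMap.comp_sub, h', hc, neg_one_mul, hn]
  abel

theorem phi2_Delta2 (h : H) :
    (phi2 k H Sinv ∘ₗ Delta2 k H) h =
      twist k H H Sinv (LinearMap.mul' k H) (h ⊗ₜ (1 ⊗ₜ 1)) := by
  have h1 : LinearMap.mul' k H ∘ₗ (TensorProduct.mk k H H).flip 1 = LinearMap.id := by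
    ext
    simp
  rw [twist_one_tmul, h1, LinearMap.lTensor_id, LinearMap.id_apply]

theorem phi2_Delta2_mul (hS : ∀ a b, Sinv (a * b) = Sinv b * Sinv a) (g h : H) :
    (phi2 k H Sinv ∘ₗ Delta2 k H) (g * h) =
      twist k H H Sinv (LinearMap.mul' k H) (g ⊗ₜ (phi2 k H Sinv ∘ₗ Delta2 k H) h) := by
  rw [phi2_Delta2, phi2_Delta2, twist_mul hS]
  simp [mul_assoc]

theorem extendD_phi2_Delta2
    (hmul : ∀ a b, Sinv (a * b) = Sinv b * Sinv a) (hone : Sinv 1 = 1)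
    (hcomul : ∀ a : H, Coalgebra.comul (R := k) (Sinv a) =
      TensorProduct.map Sinv Sinv (TensorProduct.comm k H H (Coalgebra.comul (R := k) a))) :
    extendD k H (phi2 k H Sinv ∘ₗ Delta2 k H) ∘ₗ phi2 k H Sinv ∘ₗ Delta2 k H = 0 := by
  have h1 : (phi2 k H Sinv ∘ₗ Delta2 k H) 1 = 1 ⊗ₜ 1 := by
    simp [phi2, Delta2, sw3, Algebra.TensorProduct.one_def, hone]
  refine LinearMap.ext fun h => ?_
  rw [LinearMap.comp_apply, phi2_Delta2, extendD_twist hcomul, extendD_one_tmul, h1, sub_self,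
    tmul_zero, map_zero, LinearMap.zero_apply]
  intro g x
  rw [LinearMap.mul'_apply, phi2_Delta2_mul hmul]

end Twist

section Complex

variable {k H Sinv}

theorem sinv_mul (hS1 : Sinv ∘ₗ HopfAlgebra.antipode (R := k) = LinearMap.id)
    (hS2 : HopfAlgebra.antipode (R := k) ∘ₗ Sinv = LinearMap.id) (a b : H) :
    Sinv (a * b) = Sinv b * Sinv a := by
  have h1 (x : H) : Sinv (HopfAlgebra.antipode k x) = x := LinearMap.congr_fun hS1 x
  have h2 (x : H) : HopfAlgebra.antipode k (Sinv x) = x := LinearMap.congr_fun hS2 x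
  rw [← h1 (Sinv b * Sinv a), HopfAlgebra.antipode_mul_antidistrib, h2, h2]

theorem sinv_one (hS1 : Sinv ∘ₗ HopfAlgebra.antipode (R := k) = LinearMap.id) :
    Sinv (1 : H) = 1 := by
  simpa using LinearMap.congr_fun hS1 1

open WithConv in
theorem comul_antipode (a : H) :
    Coalgebra.comul (R := k) (HopfAlgebra.antipode k a) =
      TensorProduct.map (HopfAlgebra.antipode k) (HopfAlgebra.antipode k)
        (TensorProduct.comm k H H (Coalgebra.comul (R := k) a)) := by
  let i₁ : H →ₐ[k] H ⊗[k] H := Algebra.TensorProduct.includeLeft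
  let i₂ : H →ₐ[k] H ⊗[k] H := Algebra.TensorProduct.includeRight
  let S : H →ₗ[k] H := HopfAlgebra.antipode k
  have hi (i : H →ₐ[k] H ⊗[k] H) :
      toConv i.toLinearMap * toConv (i.toLinearMap ∘ₗ S) = 1 := by
    have h := LinearMap.algHom_comp_convMul_distrib i (toConv LinearMap.id) (toConv S)
    rw [LinearMap.id_mul_antipode] at h
    refine (congrArg toConv h).symm.trans ?_
    apply WithConv.ofConv_injective
    ext x
    simp [LinearMap.convOne_def]
  have hδ : toConv (Coalgebra.comul (R := k) (A := H)) =
      toConv i₁.toLinearMap * toConv i₂.toLinearMap := by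
    apply WithConv.ofConv_injective
    refine LinearMap.ext fun x => ?_
    simp only [LinearMap.convMul_def, ofConv_toConv, LinearMap.comp_apply]
    induction Coalgebra.comul (R := k) x with
    | zero => simp
    | add s t hs ht => simp only [map_add, ← hs, ← ht]
    | tmul p q => simp [i₁, i₂]
  have hG : toConv (TensorProduct.map S S ∘ₗ (TensorProduct.comm k H H).toLinearMap ∘ₗ
        Coalgebra.comul (R := k)) =
      toConv (i₂.toLinearMap ∘ₗ S) * toConv (i₁.toLinearMap ∘ₗ S) := by
    apply WithConv.ofConv_injective
    refine LinearMap.ext fun x => ?_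
    simp only [LinearMap.convMul_def, ofConv_toConv, LinearMap.comp_apply]
    induction Coalgebra.comul (R := k) x with
    | zero => simp
    | add s t hs ht => simp only [map_add, hs, ht]
    | tmul p q => simp [i₁, i₂]
  have hright : toConv (Coalgebra.comul (R := k) (A := H)) *
      toConv (TensorProduct.map S S ∘ₗ (TensorProduct.comm k H H).toLinearMap ∘ₗ
        Coalgebra.comul (R := k)) = 1 := by
    rw [hδ, hG, mul_assoc, ← mul_assoc (toConv i₂.toLinearMap), hi, one_mul, hi]
  have hleft : toConv (Coalgebra.comul (R := k) ∘ₗ S) *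
      toConv (Coalgebra.comul (R := k) (A := H)) = 1 := by
    have h := LinearMap.algHom_comp_convMul_distrib (Bialgebra.comulAlgHom k H)
      (toConv S) (toConv LinearMap.id)
    rw [LinearMap.antipode_mul_id] at h
    refine (congrArg toConv h).symm.trans ?_
    apply WithConv.ofConv_injective
    ext x
    simp [LinearMap.convOne_def]
  exact LinearMap.congr_fun (congrArg ofConv (left_inv_eq_right_inv hleft hright)) a

theorem comul_sinv (hS1 : Sinv ∘ₗ HopfAlgebra.antipode (R := k) = LinearMap.id)
    (hS2 : HopfAlgebra.antipode (R := k) ∘ₗ Sinv = LinearMap.id) (a : H) :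
    Coalgebra.comul (R := k) (Sinv a) =
      TensorProduct.map Sinv Sinv (TensorProduct.comm k H H (Coalgebra.comul (R := k) a)) := by
  have h2 : HopfAlgebra.antipode k (Sinv a) = a := LinearMap.congr_fun hS2 a
  conv_rhs => rw [← h2, comul_antipode]
  induction Coalgebra.comul (R := k) (Sinv a) with
  | zero => simp
  | add s t hs ht => simp only [map_add, ← hs, ← ht]
  | tmul p q =>
    have h1 (x : H) : Sinv (HopfAlgebra.antipode k x) = x := LinearMap.congr_fun hS1 x
    simp [h1]

variable (k H Sinv) in
/-- The differential plus `Ψ ↦ 1 ⊗ Ψ`. -/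
def shiftedD (n : ℕ) : KC k H n →ₗ[k] H ⊗[k] KC k H n :=
  unroll k H n ∘ₗ dK k H Sinv n + TensorProduct.mk k H (KC k H n) 1

theorem dK_apply (n : ℕ) (z : KC k H n) :
    dK k H Sinv n z = (shiftedD k H Sinv n z - 1 ⊗ₜ z : H ⊗[k] KC k H n) :=
  (add_sub_cancel_right (G := H ⊗[k] KC k H n) _ _).symm

theorem shiftedD_zero : shiftedD k H Sinv 0 = phi2 k H Sinv ∘ₗ Delta2 k H :=
  sub_add_cancel (G := H →ₗ[k] H ⊗[k] H) _ _

theorem shiftedD_succ (n : ℕ) :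
    shiftedD k H Sinv (n + 1) = extendD k H (shiftedD k H Sinv n) := by
  have h : extendD k H (shiftedD k H Sinv n) = comulAssoc k H (KC k H n) -
      ((unroll k H n ∘ₗ dK k H Sinv n).lTensor H + (TensorProduct.mk k H (KC k H n) 1).lTensor H) := by
    rw [extendD, shiftedD, LinearMap.lTensor_add]
  have h' : shiftedD k H Sinv (n + 1) = comulAssoc k H (KC k H n) -
      TensorProduct.mk k H (H ⊗[k] (KC k H n)) 1 -
      (TensorProduct.mk k H (KC k H n) 1).lTensor H -
      (unroll k H n ∘ₗ dK k H Sinv n).lTensor H + TensorProduct.mk k H (H ⊗[k] KC k H n) 1 := rfl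
  rw [h, h']
  abel

theorem lactK_mul (hS : ∀ a b, Sinv (a * b) = Sinv b * Sinv a) (n : ℕ) (g h : H)
    (z : KC k H n) :
    lactK k H Sinv n ((g * h) ⊗ₜ z) = lactK k H Sinv n (g ⊗ₜ lactK k H Sinv n (h ⊗ₜ z)) := by
  induction n generalizing g h with
  | zero => exact mul_assoc g h z
  | succ n ih => exact twist_mul hS _ (fun g h x => ih g h x) g h z

variable (Sinv) in
/-- Right multiplication by `Φ`. -/
def mulRight (n : ℕ) {m : ℕ} (Φ : KC k H m) : KC k H n →ₗ[k] KC k H (m + n) :=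
  muK k H Sinv n m ∘ₗ (TensorProduct.mk k _ _).flip Φ

theorem mulRight_succ (n : ℕ) {m : ℕ} (Φ : KC k H m) (z : H ⊗[k] KC k H n) :
    mulRight Sinv (n + 1) Φ z = (mulRight Sinv n Φ).lTensor H z :=
  LinearMap.congr_fun (f := (mulRight Sinv (n + 1) Φ : H ⊗[k] KC k H n →ₗ[k] H ⊗[k] KC k H (m + n)))
    (g := (mulRight Sinv n Φ).lTensor H) (TensorProduct.ext' fun _ _ => rfl) z

theorem mulRight_lactK (hS : ∀ a b, Sinv (a * b) = Sinv b * Sinv a) (m : ℕ) {l : ℕ} (h : H)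
    (Φ : KC k H m) (Ξ : KC k H l) :
    mulRight Sinv m Ξ (lactK k H Sinv m (h ⊗ₜ Φ)) =
      lactK k H Sinv (l + m) (h ⊗ₜ mulRight Sinv m Ξ Φ) := by
  induction m generalizing h with
  | zero => exact lactK_mul hS l h Φ Ξ
  | succ m ih =>
    refine (mulRight_succ m Ξ _).trans ((twist_lTensor (fun h x => ih h x) h Φ).trans ?_)
    exact congrArg (fun w : H ⊗[k] KC k H (l + m) => lactK k H Sinv (l + m + 1) (h ⊗ₜ w))
      (mulRight_succ m Ξ Φ).symm

theorem shiftedD_lactK (hmul : ∀ a b, Sinv (a * b) = Sinv b * Sinv a)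
    (hcomul : ∀ a : H, Coalgebra.comul (R := k) (Sinv a) =
      TensorProduct.map Sinv Sinv (TensorProduct.comm k H H (Coalgebra.comul (R := k) a)))
    (n : ℕ) (h : H) (z : KC k H n) :
    shiftedD k H Sinv n (lactK k H Sinv n (h ⊗ₜ z)) =
      twist k H (KC k H n) Sinv (lactK k H Sinv n) (h ⊗ₜ shiftedD k H Sinv n z) := by
  induction n generalizing h with
  | zero =>
    rw [shiftedD_zero]
    exact phi2_Delta2_mul (H := H) hmul h z
  | succ n ih =>
    rw [shiftedD_succ]
    exact extendD_twist hcomul (fun h x => ih h x) h z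

theorem shiftedD_comp_shiftedD (hmul : ∀ a b, Sinv (a * b) = Sinv b * Sinv a) (hone : Sinv 1 = 1)
    (hcomul : ∀ a : H, Coalgebra.comul (R := k) (Sinv a) =
      TensorProduct.map Sinv Sinv (TensorProduct.comm k H H (Coalgebra.comul (R := k) a)))
    (n : ℕ) : extendD k H (shiftedD k H Sinv n) ∘ₗ shiftedD k H Sinv n = 0 := by
  induction n with
  | zero =>
    have key : extendD k H (phi2 k H Sinv ∘ₗ Delta2 k H) ∘ₗ phi2 k H Sinv ∘ₗ Delta2 k H = 0 :=
      extendD_phi2_Delta2 hmul hone hcomul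
    rw [shiftedD_zero]
    exact key
  | succ n ih =>
    rw [shiftedD_succ]
    exact extendD_extendD ih

theorem dK_dK (hmul : ∀ a b, Sinv (a * b) = Sinv b * Sinv a) (hone : Sinv 1 = 1)
    (hcomul : ∀ a : H, Coalgebra.comul (R := k) (Sinv a) =
      TensorProduct.map Sinv Sinv (TensorProduct.comm k H H (Coalgebra.comul (R := k) a)))
    (n : ℕ) (z : KC k H n) : dK k H Sinv (n + 1) (dK k H Sinv n z) = 0 := by
  have h : extendD k H (shiftedD k H Sinv n) (shiftedD k H Sinv n z) = 0 :=
    LinearMap.congr_fun (shiftedD_comp_shiftedD hmul hone hcomul n) z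
  have h' : extendD k H (shiftedD k H Sinv n) (shiftedD k H Sinv n z - 1 ⊗ₜ z) -
      1 ⊗ₜ (shiftedD k H Sinv n z - 1 ⊗ₜ z) = 0 := by
    rw [map_sub, h, extendD_one_tmul, tmul_sub, zero_sub, neg_sub, sub_self]
  rw [dK_apply, shiftedD_succ, dK_apply]
  exact h'

theorem dcast_tmul {a b : ℕ} (h : a = b) (h' : a + 1 = b + 1) (x : H) (z : KC k H a) :
    dcast k H h' (x ⊗ₜ[k] z : H ⊗[k] KC k H a) = (x ⊗ₜ[k] dcast k H h z : H ⊗[k] KC k H b) := by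
  subst h
  rfl

theorem mulRight_mulRight (hS : ∀ a b, Sinv (a * b) = Sinv b * Sinv a)
    (n : ℕ) {m l : ℕ} (Φ : KC k H m) (Ξ : KC k H l) :
    mulRight Sinv (m + n) Ξ ∘ₗ mulRight Sinv n Φ =
      dcast k H (Nat.add_assoc l m n) ∘ₗ mulRight Sinv n (mulRight Sinv m Ξ Φ) := by
  induction n with
  | zero => exact LinearMap.ext fun h => mulRight_lactK hS m h Φ Ξ
  | succ n ih =>
    refine TensorProduct.ext' fun x y => ?_
    exact (congrArg (TensorProduct.mk k H (KC k H (l + (m + n))) x)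
      (LinearMap.congr_fun ih y)).trans (dcast_tmul (Nat.add_assoc l m n) _ x _).symm

theorem shiftedD_mulRight (hmul : ∀ a b, Sinv (a * b) = Sinv b * Sinv a)
    (hcomul : ∀ a : H, Coalgebra.comul (R := k) (Sinv a) =
      TensorProduct.map Sinv Sinv (TensorProduct.comm k H H (Coalgebra.comul (R := k) a)))
    (n : ℕ) {m : ℕ} (Φ : KC k H m) :
    shiftedD k H Sinv (m + n) ∘ₗ mulRight Sinv n Φ =
      (mulRight Sinv n Φ).lTensor H ∘ₗ shiftedD k H Sinv n +
        ((-1 : k) ^ n) • (unroll k H (m + n) ∘ₗ dcast k H (Nat.add_right_comm m 1 n) ∘ₗ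
          mulRight Sinv n (dK k H Sinv m Φ)) := by
  induction n with
  | zero =>
    refine LinearMap.ext fun h => ?_
    have key (h : H) :
        twist k H (KC k H m) Sinv (lactK k H Sinv m) (h ⊗ₜ shiftedD k H Sinv m Φ) =
        (lactK k H Sinv m ∘ₗ (TensorProduct.mk k H (KC k H m)).flip Φ).lTensor H
            ((phi2 k H Sinv ∘ₗ Delta2 k H) h) +
          twist k H (KC k H m) Sinv (lactK k H Sinv m)
            (h ⊗ₜ (shiftedD k H Sinv m Φ - 1 ⊗ₜ Φ)) := by
      rw [← twist_one_tmul, ← map_add, ← tmul_add, add_sub_cancel]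
    refine (shiftedD_lactK hmul hcomul m h Φ).trans ((key h).trans ?_)
    rw [shiftedD_zero, dK_apply, pow_zero, one_smul]
    rfl
  | succ n ih =>
    let ν : H ⊗[k] KC k H n →ₗ[k] H ⊗[k] (H ⊗[k] KC k H (m + n)) :=
      unroll k H (m + (n + 1)) ∘ₗ dcast k H (Nat.add_right_comm m 1 (n + 1)) ∘ₗ
        mulRight Sinv (n + 1) (dK k H Sinv m Φ)
    have hν : (unroll k H (m + n) ∘ₗ dcast k H (Nat.add_right_comm m 1 n) ∘ₗ
        mulRight Sinv n (dK k H Sinv m Φ)).lTensor H = ν :=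
      TensorProduct.ext' fun x y => (dcast_tmul (Nat.add_right_comm m 1 n) _ x _).symm
    have h := extendD_comp_lTensor ih
    rw [hν, ← pow_succ', ← shiftedD_succ, ← shiftedD_succ] at h
    have hm : (mulRight Sinv (n + 1) Φ : H ⊗[k] KC k H n →ₗ[k] H ⊗[k] KC k H (m + n)) =
      (mulRight Sinv n Φ).lTensor H := LinearMap.ext (mulRight_succ n Φ)
    rw [← hm] at h
    exact h

theorem dK_mulRight (hmul : ∀ a b, Sinv (a * b) = Sinv b * Sinv a)
    (hcomul : ∀ a : H, Coalgebra.comul (R := k) (Sinv a) =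
      TensorProduct.map Sinv Sinv (TensorProduct.comm k H H (Coalgebra.comul (R := k) a)))
    (n : ℕ) {m : ℕ} (Ψ : KC k H n) (Φ : KC k H m) :
    dK k H Sinv (m + n) (mulRight Sinv n Φ Ψ) =
      mulRight Sinv (n + 1) Φ (dK k H Sinv n Ψ) + ((-1 : k) ^ n) •
        dcast k H (Nat.add_right_comm m 1 n) (mulRight Sinv n (dK k H Sinv m Φ) Ψ) := by
  have h := LinearMap.congr_fun (shiftedD_mulRight hmul hcomul n Φ) Ψ
  have h' : shiftedD k H Sinv (m + n) (mulRight Sinv n Φ Ψ) - 1 ⊗ₜ mulRight Sinv n Φ Ψ =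
      (mulRight Sinv n Φ).lTensor H (shiftedD k H Sinv n Ψ - 1 ⊗ₜ Ψ) + ((-1 : k) ^ n) •
        unroll k H (m + n)
          (dcast k H (Nat.add_right_comm m 1 n) (mulRight Sinv n (dK k H Sinv m Φ) Ψ)) := by
    rw [LinearMap.comp_apply] at h
    rw [h, map_sub, LinearMap.lTensor_tmul, LinearMap.add_apply, add_sub_right_comm]
    rfl
  refine (dK_apply _ _).trans (h'.trans ?_)
  rw [← mulRight_succ, ← dK_apply]
  rfl

end Complex

theorem statement10
    (hS1 : Sinv ∘ₗ HopfAlgebra.antipode (R := k) = LinearMap.id)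
    (hS2 : HopfAlgebra.antipode (R := k) ∘ₗ Sinv = LinearMap.id) :
    -- the product is associative:
    (∀ (n m l : ℕ) (Ψ : KC k H n) (Φ : KC k H m) (Ξ : KC k H l),
      muK k H Sinv (m + n) l ((muK k H Sinv n m (Ψ ⊗ₜ[k] Φ)) ⊗ₜ[k] Ξ) =
        dcast k H (Nat.add_assoc l m n)
          (muK k H Sinv n (l + m) (Ψ ⊗ₜ[k] muK k H Sinv m l (Φ ⊗ₜ[k] Ξ)))) ∧
    -- the graded Leibniz rule `d(ΨΦ) = d(Ψ)Φ + (−1)^{|Ψ|} Ψ d(Φ)` :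
    (∀ (n m : ℕ) (Ψ : KC k H n) (Φ : KC k H m),
      dK k H Sinv (m + n) (muK k H Sinv n m (Ψ ⊗ₜ[k] Φ)) =
        dcast k H (Nat.add_succ m n)
          (muK k H Sinv (n + 1) m ((dK k H Sinv n Ψ) ⊗ₜ[k] Φ))
        + ((-1 : k) ^ n) •
            dcast k H (Nat.add_right_comm m 1 n)
              (muK k H Sinv n (m + 1) (Ψ ⊗ₜ[k] dK k H Sinv m Φ))) ∧
    -- `d² = 0` :
    (∀ n : ℕ, (dK k H Sinv (n + 1)) ∘ₗ (dK k H Sinv n) = 0) := by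
  have hmul := sinv_mul hS1 hS2
  have hcomul := comul_sinv hS1 hS2
  exact ⟨fun n m l Ψ Φ Ξ => LinearMap.congr_fun (mulRight_mulRight hmul n Φ Ξ) Ψ,
    fun n m Ψ Φ => dK_mulRight hmul hcomul n Ψ Φ,
    fun n => LinearMap.ext (dK_dK hmul (sinv_one hS1) hcomul n)⟩

end
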